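/- Let G be a simple odd multi-cactus different from K2, and let u and v be two vertices of G belonging to the same bipartition class (possibly u = v). Then there exists a {0,1}-weighting w of G such that the vertex colouring that assigns to u and to v their weighted degrees increased by 1 (to u = v its weighted degree increased by 2 in case u = v) and to every other vertex its weighted degree, is a proper vertex colouring (adjacent vertices receive distinct values). -/

import Mathlib

open scoped Classical

/-- The weighted degree of vertex `v` under edge-weighting `w`:
the sum of the weights of the edges incident with `v`. -/
noncomputable def wdeg {V : Type} [Fintype V] (G : SimpleGraph V) (w : Sym2 V → ℕ) (v : V) : ℕ :=
  ∑ u ∈ Finset.univ.filter (fun u => G.Adj v u), w s(v, u)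

/-- `w` is a `{0,1}`-weighting of `G`: every edge gets weight `0` or `1`. -/
def Is01Weighting {V : Type} (G : SimpleGraph V) (w : Sym2 V → ℕ) : Prop :=
  ∀ e ∈ G.edgeSet, w e = 0 ∨ w e = 1

/-- `G` has the `{0,1}`-property: it admits a proper (neighbour sum-distinguishing)
`{0,1}`-edge-weighting. A graph without this property is called *bad*. -/
def HasZeroOneProperty {V : Type} [Fintype V] (G : SimpleGraph V) : Prop :=
  ∃ w : Sym2 V → ℕ, Is01Weighting G w ∧
    ∀ ⦃u v : V⦄, G.Adj u v → wdeg G w u ≠ wdeg G w v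
/-- The `i`-th vertex of a path from `u` to `v` with `n` fresh internal vertices. -/
def pathVert {V : Type} (u v : V) (n : ℕ) (i : Fin (n + 2)) : V ⊕ Fin n :=
  if h0 : i.1 = 0 then Sum.inl u
  else if hn : i.1 ≤ n then Sum.inr ⟨i.1 - 1, by omega⟩
  else Sum.inl v

/-- The edges of a path of length `n + 1` from `u` to `v` with `n` fresh internal vertices. -/
def pathEdges {V : Type} (u v : V) (n : ℕ) : Set (Sym2 (V ⊕ Fin n)) :=
  {e | ∃ i : Fin (n + 1), e = s(pathVert u v n i.castSucc, pathVert u v n i.succ)}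

/-- The green edges of such a path, coloured alternately red, green, …, green, red
(so the `i`-th edge is green exactly when `i` is odd). -/
def greenPathEdges {V : Type} (u v : V) (n : ℕ) : Set (Sym2 (V ⊕ Fin n)) :=
  {e | ∃ i : Fin (n + 1), Odd i.1 ∧ e = s(pathVert u v n i.castSucc, pathVert u v n i.succ)}

/-- The graph obtained from `G` by adding a path of length `n + 1` from `u` to `v`,
internally disjoint from `G` (its `n` internal vertices are fresh). -/
def addPathGraph {V : Type} (G : SimpleGraph V) (u v : V) (n : ℕ) :
    SimpleGraph (V ⊕ Fin n) :=
  SimpleGraph.fromEdgeSet ((Sym2.map Sum.inl '' G.edgeSet) ∪ pathEdges u v n)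

/-- The recursion building simple odd multi-cacti together with their red-green
edge-colouring (given by the set of green edges): `K₂` with its unique edge green is a simple
odd multi-cactus, and one may repeatedly add, along a green edge `uv`, a new internally
disjoint path of length `l ≡ 1 [MOD 4]`, `l ≥ 5` (here `l = 4 * k + 5`), whose edges are
coloured alternately red, green, …, green, red. -/
inductive OMC : ∀ (V : Type), SimpleGraph V → Set (Sym2 V) → Prop
  | k2 : OMC (Fin 2) ⊤ ((⊤ : SimpleGraph (Fin 2)).edgeSet)
  | addPath {V : Type} {G : SimpleGraph V} {green : Set (Sym2 V)} (h : OMC V G green)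
      (u v : V) (hadj : G.Adj u v) (hgreen : s(u, v) ∈ green) (k : ℕ) :
      OMC (V ⊕ Fin (4 * k + 4)) (addPathGraph G u v (4 * k + 4))
        (Sym2.map Sum.inl '' green ∪ greenPathEdges u v (4 * k + 4))

/-- `G` is a simple odd multi-cactus: it is isomorphic to a graph produced by the
recursion `OMC`. -/
def IsSimpleOddMultiCactus {V : Type} (G : SimpleGraph V) : Prop :=
  ∃ (W : Type) (H : SimpleGraph W) (green : Set (Sym2 W)),
    OMC W H green ∧ Nonempty (G ≃g H)

section

variable {V : Type}

theorem pathVert_eq_inl_iff {u v : V} {n : ℕ} {i : Fin (n + 2)} {a : V} :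
    pathVert u v n i = Sum.inl a ↔ (i.1 = 0 ∧ a = u) ∨ (i.1 = n + 1 ∧ a = v) := by
  have := i.2
  unfold pathVert
  split_ifs with h0 h1
  · simp [h0, eq_comm]
  · simp only [false_iff]
    omega
  · have : i.1 = n + 1 := by omega
    simp [this, eq_comm]

theorem pathVert_eq_inr_iff {u v : V} {n : ℕ} {i : Fin (n + 2)} {j : Fin n} :
    pathVert u v n i = Sum.inr j ↔ i.1 = j.1 + 1 := by
  have := i.2
  have := j.2
  unfold pathVert
  split_ifs with h0 h1
  · simp only [false_iff]
    omega
  · simp only [Sum.inr.injEq, Fin.ext_iff]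
    omega
  · simp only [false_iff]
    omega

theorem addPathGraph_adj_inl_inl {G : SimpleGraph V} {u v : V} {n : ℕ} (hn : 1 ≤ n) {a b : V} :
    (addPathGraph G u v n).Adj (Sum.inl a) (Sum.inl b) ↔ G.Adj a b := by
  simp only [addPathGraph, SimpleGraph.fromEdgeSet_adj, Set.mem_union, ne_eq, Sum.inl.injEq]
  constructor
  · rintro ⟨⟨e, he, h⟩ | ⟨i, h⟩, hne⟩
    · induction e with
      | _ x y =>
        simp only [Sym2.map_mk, Sym2.eq_iff, Sum.inl.injEq] at h
        rcases h with ⟨rfl, rfl⟩ | ⟨rfl, rfl⟩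
        · exact he
        · exact SimpleGraph.Adj.symm he
    · rw [Sym2.eq_iff] at h
      have := i.2
      rcases h with ⟨h1, h2⟩ | ⟨h1, h2⟩ <;>
      · rw [eq_comm, pathVert_eq_inl_iff] at h1 h2
        simp only [Fin.val_castSucc, Fin.val_succ] at h1 h2
        omega
  · intro h
    exact ⟨Or.inl ⟨s(a, b), h, by simp⟩, h.ne⟩

theorem addPathGraph_adj_inl_inr {G : SimpleGraph V} {u v : V} {n : ℕ} {a : V} {i : Fin n} :
    (addPathGraph G u v n).Adj (Sum.inl a) (Sum.inr i) ↔
      (a = u ∧ i.1 = 0) ∨ (a = v ∧ i.1 + 1 = n) := by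
  have hi := i.2
  simp only [addPathGraph, SimpleGraph.fromEdgeSet_adj, Set.mem_union, ne_eq, reduceCtorEq,
    not_false_eq_true, and_true]
  constructor
  · rintro (⟨e, he, h⟩ | ⟨j, h⟩)
    · induction e with
      | _ x y => simp at h
    · rw [Sym2.eq_iff] at h
      have := j.2
      rcases h with ⟨h1, h2⟩ | ⟨h1, h2⟩ <;>
      · rw [eq_comm, pathVert_eq_inl_iff] at h1
        rw [eq_comm, pathVert_eq_inr_iff] at h2
        simp only [Fin.val_castSucc, Fin.val_succ] at h1 h2
        rcases h1 with ⟨h1, rfl⟩ | ⟨h1, rfl⟩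
        · left; exact ⟨rfl, by omega⟩
        · right; exact ⟨rfl, by omega⟩
  · rintro (⟨rfl, h⟩ | ⟨rfl, h⟩)
    · refine Or.inr ⟨⟨0, by omega⟩, ?_⟩
      rw [eq_comm, Sym2.eq_iff]
      left
      simp [pathVert_eq_inl_iff, pathVert_eq_inr_iff, h]
    · refine Or.inr ⟨⟨n, by omega⟩, ?_⟩
      rw [eq_comm, Sym2.eq_iff]
      right
      simp [pathVert_eq_inl_iff, pathVert_eq_inr_iff, h]

theorem addPathGraph_adj_inr_inr {G : SimpleGraph V} {u v : V} {n : ℕ} {i j : Fin n} :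
    (addPathGraph G u v n).Adj (Sum.inr i) (Sum.inr j) ↔ i.1 + 1 = j.1 ∨ j.1 + 1 = i.1 := by
  have hi := i.2
  have hj := j.2
  simp only [addPathGraph, SimpleGraph.fromEdgeSet_adj, Set.mem_union, ne_eq, Sum.inr.injEq]
  constructor
  · rintro ⟨⟨e, he, h⟩ | ⟨m, h⟩, hne⟩
    · induction e with
      | _ x y => simp at h
    · rw [Sym2.eq_iff] at h
      rcases h with ⟨h1, h2⟩ | ⟨h1, h2⟩ <;>
      · rw [eq_comm, pathVert_eq_inr_iff] at h1 h2
        simp only [Fin.val_castSucc, Fin.val_succ] at h1 h2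
        omega
  · intro h
    refine ⟨Or.inr ?_, by rintro rfl; omega⟩
    rcases h with h | h
    · refine ⟨⟨j, by omega⟩, ?_⟩
      rw [eq_comm, Sym2.eq_iff]
      left
      simp [pathVert_eq_inr_iff, h]
    · refine ⟨⟨i, by omega⟩, ?_⟩
      rw [eq_comm, Sym2.eq_iff]
      right
      simp [pathVert_eq_inr_iff, h]

/-- The weighting of `addPathGraph G u v n` that agrees with `w` on `G` and gives the `i`-th edge
of the new path weight `e i`. -/
def extendWeight (n : ℕ) (w : Sym2 V → ℕ) (e : ℕ → ℕ) : Sym2 (V ⊕ Fin n) → ℕ :=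
  Sym2.lift ⟨fun p q => match p, q with
    | Sum.inl a, Sum.inl b => w s(a, b)
    | Sum.inr i, Sum.inr j => e (max i.1 j.1)
    | Sum.inl _, Sum.inr i => if i.1 = 0 then e 0 else e n
    | Sum.inr i, Sum.inl _ => if i.1 = 0 then e 0 else e n, by
      rintro (a | i) (b | j)
      · simp [Sym2.eq_swap]
      · rfl
      · rfl
      · simp [max_comm]⟩

theorem extendWeight_le_one {n : ℕ} {w : Sym2 V → ℕ} {e : ℕ → ℕ} (hw : ∀ s, w s ≤ 1)
    (he : ∀ i, e i ≤ 1) (s : Sym2 (V ⊕ Fin n)) : extendWeight n w e s ≤ 1 := by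
  induction s with
  | _ p q =>
    rcases p with a | i <;> rcases q with b | j <;> simp only [extendWeight, Sym2.lift_mk]
    · exact hw _
    · split_ifs <;> exact he _
    · split_ifs <;> exact he _
    · exact he _

theorem wdeg_extendWeight_inl [Fintype V] {G : SimpleGraph V} {u v : V} {n : ℕ} (hn : 2 ≤ n)
    (w : Sym2 V → ℕ) (e : ℕ → ℕ) (a : V) :
    wdeg (addPathGraph G u v n) (extendWeight n w e) (Sum.inl a) =
      wdeg G w a + (if a = u then e 0 else 0) + (if a = v then e n else 0) := by
  unfold wdeg
  rw [Finset.sum_filter, Fintype.sum_sum_type, Finset.sum_filter, add_assoc]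
  congr 1
  · refine Finset.sum_congr rfl fun b _ => ?_
    simp only [addPathGraph_adj_inl_inl (show 1 ≤ n by omega), extendWeight, Sym2.lift_mk]
  · have h : ∀ i : Fin n, (if (addPathGraph G u v n).Adj (Sum.inl a) (Sum.inr i) then
        extendWeight n w e s(Sum.inl a, Sum.inr i) else 0) =
        (if i = ⟨0, by omega⟩ then (if a = u then e 0 else 0) else 0) +
        (if i = ⟨n - 1, by omega⟩ then (if a = v then e n else 0) else 0) := by
      intro i
      simp only [addPathGraph_adj_inl_inr, extendWeight, Sym2.lift_mk, Fin.ext_iff]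
      by_cases h0 : i.1 = 0 <;> by_cases h1 : i.1 = n - 1
      · omega
      · simp [h0, show ¬ (1 = n) by omega, show ¬ (0 = n - 1) by omega]
      · simp [h1, show ¬ (n - 1 = 0) by omega,
          show n - 1 + 1 = n by omega]
      · simp [h0, h1, show ¬ (i.1 + 1 = n) by omega]
    rw [Finset.sum_congr rfl fun i _ => h i, Finset.sum_add_distrib]
    simp

theorem wdeg_extendWeight_inr [Fintype V] {G : SimpleGraph V} {u v : V} {n : ℕ} (hn : 2 ≤ n)
    (w : Sym2 V → ℕ) (e : ℕ → ℕ) (i : Fin n) :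
    wdeg (addPathGraph G u v n) (extendWeight n w e) (Sum.inr i) = e i + e (i + 1) := by
  have hi := i.2
  unfold wdeg
  rw [Finset.sum_filter, Fintype.sum_sum_type]
  have h1 : ∀ a : V, (if (addPathGraph G u v n).Adj (Sum.inr i) (Sum.inl a) then
        extendWeight n w e s(Sum.inr i, Sum.inl a) else 0) =
        (if a = u then (if i.1 = 0 then e 0 else 0) else 0) +
        (if a = v then (if i.1 + 1 = n then e n else 0) else 0) := by
    intro a
    rw [SimpleGraph.adj_comm]
    simp only [addPathGraph_adj_inl_inr, extendWeight, Sym2.lift_mk]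
    by_cases h0 : i.1 = 0 <;> by_cases h1 : i.1 + 1 = n
    · omega
    · simp [h0, show ¬ (1 = n) by omega]
    · simp [h0, h1]
    · simp [h0, h1]
  have h2 : ∀ j : Fin n, (if (addPathGraph G u v n).Adj (Sum.inr i) (Sum.inr j) then
        extendWeight n w e s(Sum.inr i, Sum.inr j) else 0) =
        (if j = ⟨i.1 - 1, by omega⟩ then (if i.1 = 0 then 0 else e i) else 0) +
        (if j = ⟨(i.1 + 1) % n, Nat.mod_lt _ (by omega)⟩ then
          (if i.1 + 1 = n then 0 else e (i + 1)) else 0) := by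
    intro j
    have hj := j.2
    simp only [addPathGraph_adj_inr_inr, extendWeight, Sym2.lift_mk, Fin.ext_iff]
    by_cases h1 : i.1 + 1 = n
    · by_cases h3 : j.1 + 1 = i.1
      · simp [h1, show j.1 = i.1 - 1 by omega, show i.1 ≠ 0 by omega,
          show i.1 - 1 + 1 = i.1 by omega]
      · simp [h1, h3, show n ≠ j.1 by omega,
          show j.1 ≠ i.1 - 1 by omega]
    · rw [Nat.mod_eq_of_lt (show i.1 + 1 < n by omega)]
      by_cases h3 : j.1 + 1 = i.1
      · simp [show j.1 = i.1 - 1 by omega, show i.1 ≠ 0 by omega,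
          show i.1 - 1 + 1 = i.1 by omega, show i.1 - 1 ≠ i.1 + 1 by omega]
      · by_cases h4 : j.1 = i.1 + 1
        · simp [h4, h1]
          omega
        · have : i.1 + 1 ≠ j.1 := by omega
          by_cases h5 : i.1 = 0
          · simp [h5, show j.1 ≠ 1 by omega, show 1 ≠ j.1 by omega]
          · simp [h3, h4, this, show j.1 ≠ i.1 - 1 by omega]
  rw [Finset.sum_congr rfl fun a _ => h1 a, Finset.sum_congr rfl fun j _ => h2 j,
    Finset.sum_add_distrib, Finset.sum_add_distrib]
  simp only [Finset.sum_ite_eq', Finset.mem_univ, if_true]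
  by_cases h0 : i.1 = 0 <;> by_cases h3 : i.1 + 1 = n
  · omega
  · simp [h0, show 1 ≠ n by omega]
  · simp [h0, h3, add_comm]
  · simp [h0, h3]

/-- A colouring of `addPathGraph G u v n` alternates along the new path. -/
theorem addPathGraph_coloring_inr {G : SimpleGraph V} {u v : V} {n : ℕ}
    {c : V ⊕ Fin n → Bool} (hc : ∀ ⦃x y⦄, (addPathGraph G u v n).Adj x y → c x ≠ c y)
    (i : Fin n) :
    c (Sum.inr i) = if i.1 % 2 = 1 then c (Sum.inl u) else !c (Sum.inl u) := by
  obtain ⟨i, hi⟩ := i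
  induction i with
  | zero =>
    have := hc (addPathGraph_adj_inl_inr (G := G) (u := u) (v := v) (a := u) (i := ⟨0, hi⟩)
      |>.2 (Or.inl ⟨rfl, rfl⟩))
    simpa [eq_comm, Bool.eq_not] using this
  | succ i ih =>
    have h1 := ih (by omega)
    have h2 := hc (addPathGraph_adj_inr_inr (G := G) (u := u) (v := v) (i := ⟨i, by omega⟩)
      (j := ⟨i + 1, hi⟩) |>.2 (Or.inl rfl))
    rw [h1] at h2
    rcases Nat.mod_two_eq_zero_or_one i with h | h
    · have h' : (i + 1) % 2 = 1 := by omega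
      simp only [h, h'] at h2 ⊢
      revert h2
      cases c (Sum.inl u) <;> cases c (Sum.inr ⟨i + 1, hi⟩) <;> simp
    · have h' : (i + 1) % 2 = 0 := by omega
      simp only [h, h'] at h2 ⊢
      revert h2
      cases c (Sum.inl u) <;> cases c (Sum.inr ⟨i + 1, hi⟩) <;> simp

theorem addPathGraph_coloring_inl {G : SimpleGraph V} {u v : V} {n : ℕ} (hn : 1 ≤ n)
    {c : V ⊕ Fin n → Bool} (hc : ∀ ⦃x y⦄, (addPathGraph G u v n).Adj x y → c x ≠ c y)
    ⦃x y : V⦄ (h : G.Adj x y) : c (Sum.inl x) ≠ c (Sum.inl y) :=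
  hc ((addPathGraph_adj_inl_inl hn).2 h)

theorem OMC.finite {G : SimpleGraph V} {green : Set (Sym2 V)} (h : OMC V G green) :
    Finite V := by
  induction h with
  | k2 => infer_instance
  | addPath _ _ _ _ _ _ _ => infer_instance

theorem wdeg_mono [Fintype V] {G : SimpleGraph V} {w w' : Sym2 V → ℕ} (h : ∀ s, w s ≤ w' s)
    (x : V) : wdeg G w x ≤ wdeg G w' x :=
  Finset.sum_le_sum fun _ _ => h _

theorem one_le_extendWeight {n : ℕ} (s : Sym2 (V ⊕ Fin n)) :
    1 ≤ extendWeight n (fun _ => 1) (fun _ => 1) s := by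
  induction s with
  | _ p q => rcases p with a | i <;> rcases q with b | j <;> simp [extendWeight]

theorem wdeg_top_fin_two (w : Sym2 (Fin 2) → ℕ) (x : Fin 2) :
    wdeg (⊤ : SimpleGraph (Fin 2)) w x = w s(0, 1) := by
  fin_cases x <;> simp [wdeg, Finset.sum_filter, Sym2.eq_swap]

/-- In a simple odd multi-cactus all parities of weighted degrees with even sum are attained. -/
theorem OMC.exists_even_wdeg_add {G : SimpleGraph V} {green : Set (Sym2 V)}
    (h : OMC V G green) : ∀ [Fintype V] (t : V → ℕ), Even (∑ x, t x) →
    ∃ w : Sym2 V → ℕ, (∀ e, w e ≤ 1) ∧ ∀ x, Even (wdeg G w x + t x) := by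
  induction h with
  | k2 =>
    intro inst t ht
    obtain rfl : inst = Fin.fintype 2 := Subsingleton.elim _ _
    refine ⟨fun _ => t 0 % 2, fun _ => by dsimp only; omega, fun x => ?_⟩
    rw [wdeg_top_fin_two]
    simp only [Fin.sum_univ_two, Nat.even_iff] at ht ⊢
    fin_cases x <;> simp <;> omega
  | @addPath V G green h u v hadj hgreen k ih =>
    obtain ⟨n, hn⟩ : ∃ n, 4 * k + 4 = n := ⟨_, rfl⟩
    rw [hn]
    intro inst t ht
    have : Fintype V := Fintype.ofInjective _ (Sum.inl_injective (β := Fin n))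
    obtain rfl : inst = instFintypeSum V (Fin n) := Subsingleton.elim _ _
    have huv : u ≠ v := hadj.ne
    let D : ℕ → ℕ := fun i => if hi : i < n then t (Sum.inr ⟨i, hi⟩) else 0
    have hD : ∀ i : Fin n, t (Sum.inr i) = D i := fun i => by simp [D]
    let e : ℕ → ℕ := fun m => (∑ i ∈ Finset.range m, D i) % 2
    obtain ⟨w, hw, hw'⟩ := ih (fun x => t (Sum.inl x) + if x = v then e n else 0) (by
      rw [Fintype.sum_sum_type, Finset.sum_congr rfl fun i _ => hD i,
        Fin.sum_univ_eq_sum_range] at ht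
      simp only [Finset.sum_add_distrib, Finset.sum_ite_eq', Finset.mem_univ, if_true, e]
      rw [Nat.even_iff] at ht ⊢
      omega)
    have he : ∀ m, e m ≤ 1 := fun m => by simp only [e]; omega
    refine ⟨extendWeight n w e, extendWeight_le_one hw he, ?_⟩
    rintro (x | i)
    · rw [wdeg_extendWeight_inl (by omega)]
      have : e 0 = 0 := by simp [e]
      rw [this]
      convert hw' x using 1
      simp
      ring
    · rw [wdeg_extendWeight_inr (by omega), hD]
      simp only [e, Finset.sum_range_succ, Nat.even_iff]
      omega

/-- The bipartition classes of a simple odd multi-cactus have odd size. -/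
theorem OMC.odd_sum_class {G : SimpleGraph V} {green : Set (Sym2 V)}
    (h : OMC V G green) : ∀ [Fintype V] (c : V → Bool), (∀ ⦃x y⦄, G.Adj x y → c x ≠ c y) →
    ∀ b : Bool, Odd (∑ x, if c x = b then 1 else 0) := by
  induction h with
  | k2 =>
    intro inst c hc b
    obtain rfl : inst = Fin.fintype 2 := Subsingleton.elim _ _
    have := @hc 0 1 (by simp)
    revert this
    rw [Fin.sum_univ_two]
    cases c 0 <;> cases c 1 <;> cases b <;> simp
  | @addPath V G green h u v hadj hgreen k ih =>
    intro inst c hc b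
    have : Fintype V := Fintype.ofInjective _ (Sum.inl_injective (β := Fin (4 * k + 4)))
    obtain rfl : inst = instFintypeSum V (Fin (4 * k + 4)) := Subsingleton.elim _ _
    have h1 := ih (fun x => c (Sum.inl x)) (addPathGraph_coloring_inl (by omega) hc) b
    rw [Fintype.sum_sum_type]
    refine h1.add_even ?_
    simp only [addPathGraph_coloring_inr hc]
    rw [Fin.sum_univ_eq_sum_range (fun i => if (if i % 2 = 1 then c (Sum.inl u) else
      !c (Sum.inl u)) = b then 1 else 0)]
    generalize c (Sum.inl u) = a
    clear * -
    induction k with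
    | zero => cases a <;> cases b <;> decide
    | succ k ih =>
      rw [show 4 * (k + 1) + 4 = 4 * k + 4 + 1 + 1 + 1 + 1 by ring]
      iterate 4 rw [Finset.sum_range_succ]
      rw [Nat.even_iff] at ih ⊢
      have e1 : (4 * k + 4) % 2 = 0 := by omega
      have e2 : (4 * k + 4 + 1) % 2 = 1 := by omega
      have e3 : (4 * k + 4 + 1 + 1) % 2 = 0 := by omega
      have e4 : (4 * k + 4 + 1 + 1 + 1) % 2 = 1 := by omega
      simp only [e1, e2, e3, e4]
      cases a <;> cases b <;> simp at ih ⊢ <;> omega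

/-- With an odd total demand, the two bipartition classes can be given distinct parities. -/
theorem OMC.exists_parity {G : SimpleGraph V} {green : Set (Sym2 V)}
    (h : OMC V G green) [Fintype V] {c : V → Bool} (hc : ∀ ⦃x y⦄, G.Adj x y → c x ≠ c y)
    {d : V → ℕ} (hd : Odd (∑ x, d x)) (b : Bool) :
    ∃ w : Sym2 V → ℕ, (∀ e, w e ≤ 1) ∧
      ∀ x, (wdeg G w x + d x) % 2 = if c x = b then 0 else 1 := by
  obtain ⟨w, hw, hw'⟩ := h.exists_even_wdeg_add (fun x => d x + if c x = !b then 1 else 0) (by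
    rw [Finset.sum_add_distrib]
    exact hd.add_odd (h.odd_sum_class c hc _))
  refine ⟨w, hw, fun x => ?_⟩
  have := hw' x
  rw [Nat.even_iff] at this
  split_ifs at this ⊢ with h1 h2 h2
  · simp [h2] at h1
  · omega
  · omega
  · cases h : c x <;> cases b <;> simp_all

theorem mk_mem_greenPathEdges {u v : V} {n : ℕ} (hn : Even n) {x y : V ⊕ Fin n}
    (h : s(x, y) ∈ greenPathEdges u v n) : ∃ i j : Fin n, x = Sum.inr i ∧ y = Sum.inr j := by
  obtain ⟨i, hi, h⟩ := h
  have h1 := i.2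
  have h2 : i.1 ≠ n := by rintro h; rw [h] at hi; exact (Nat.not_even_iff_odd.2 hi) hn
  have h0 := hi.pos
  have e1 : pathVert u v n i.castSucc = Sum.inr ⟨i.1 - 1, by omega⟩ := by
    rw [pathVert_eq_inr_iff]; simp; omega
  have e2 : pathVert u v n i.succ = Sum.inr ⟨i.1, by omega⟩ := by
    rw [pathVert_eq_inr_iff]; simp
  rw [e1, e2, Sym2.eq_iff] at h
  rcases h with ⟨rfl, rfl⟩ | ⟨rfl, rfl⟩ <;> exact ⟨_, _, rfl, rfl⟩

/-- For a green edge `xy` there is a weighting in which `x` and `y` have weighted degree `1`, the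
other vertices in the class of `x` even, and those in the class of `y` odd weighted degree. -/
theorem OMC.exists_wdeg_eq_one {G : SimpleGraph V} {green : Set (Sym2 V)}
    (h : OMC V G green) : ∀ [Fintype V] {c : V → Bool},
    (∀ ⦃x y⦄, G.Adj x y → c x ≠ c y) → ∀ {x y : V}, G.Adj x y → s(x, y) ∈ green →
    ∃ w : Sym2 V → ℕ, (∀ e, w e ≤ 1) ∧ wdeg G w x = 1 ∧ wdeg G w y = 1 ∧
      ∀ z, z ≠ x → wdeg G w z % 2 = if c z = c x then 0 else 1 := by
  induction h with
  | k2 =>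
    intro inst c hc x y hxy hg
    obtain rfl : inst = Fin.fintype 2 := Subsingleton.elim _ _
    refine ⟨fun _ => 1, fun _ => le_rfl, wdeg_top_fin_two _ _, wdeg_top_fin_two _ _,
      fun z hz => ?_⟩
    rw [wdeg_top_fin_two, if_neg (hc (by simpa using hz))]
  | @addPath V G green h u v hadj hgreen k ih =>
    intro inst c hc x y hxy hg
    have : Fintype V := Fintype.ofInjective _ (Sum.inl_injective (β := Fin (4 * k + 4)))
    obtain rfl : inst = instFintypeSum V (Fin (4 * k + 4)) := Subsingleton.elim _ _
    have H := h.addPath u v hadj hgreen k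
    have huv : u ≠ v := hadj.ne
    have hc' := addPathGraph_coloring_inl (by omega) hc
    rcases hg with ⟨s, hs, hg⟩ | hg
    · obtain ⟨x, y, rfl, rfl, hxy'⟩ : ∃ x' y', x = Sum.inl x' ∧ y = Sum.inl y' ∧
          s(x', y') ∈ green := by
        induction s with
        | _ a b =>
          simp only [Sym2.map_mk, Sym2.eq_iff] at hg
          rcases hg with ⟨rfl, rfl⟩ | ⟨rfl, rfl⟩
          · exact ⟨_, _, rfl, rfl, hs⟩
          · exact ⟨_, _, rfl, rfl, by rwa [Sym2.eq_swap]⟩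
      obtain ⟨w, hw, hx, hy, hz⟩ := ih hc' ((addPathGraph_adj_inl_inl (by omega)).1 hxy) hxy'
      obtain ⟨e, he, he0, hen, hei⟩ : ∃ e : ℕ → ℕ, (∀ m, e m ≤ 1) ∧ e 0 = 0 ∧
          e (4 * k + 4) = 0 ∧ ∀ i : Fin (4 * k + 4), (e i + e (i + 1)) % 2 =
            if c (Sum.inr i) = c (Sum.inl x) then 0 else 1 := by
        simp only [addPathGraph_coloring_inr hc]
        by_cases hux : c (Sum.inl u) = c (Sum.inl x)
        · refine ⟨fun m => ((m + 1) / 2) % 2, fun m => by dsimp only; omega, by simp,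
            by dsimp only; omega, fun i => ?_⟩
          rw [hux]
          split_ifs with h1 h2 h2 <;> simp at h2 ⊢ <;> omega
        · refine ⟨fun m => (m / 2) % 2, fun m => by dsimp only; omega, by simp,
            by dsimp only; omega, fun i => ?_⟩
          rw [Bool.eq_not.2 hux]
          split_ifs with h1 h2 h2 <;> simp at h2 ⊢ <;> omega
      refine ⟨extendWeight _ w e, extendWeight_le_one hw he, ?_, ?_, ?_⟩
      · rw [wdeg_extendWeight_inl (by omega), he0, hen, hx]; simp
      · rw [wdeg_extendWeight_inl (by omega), he0, hen, hy]; simp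
      · rintro (z | i) hzx
        · rw [wdeg_extendWeight_inl (by omega), he0, hen]
          simpa using hz z (by simpa using hzx)
        · rw [wdeg_extendWeight_inr (by omega), hei]
    · obtain ⟨i, j, rfl, rfl⟩ := mk_mem_greenPathEdges (by
        rw [Nat.even_iff]; omega) hg
      obtain ⟨w, hw, hpar⟩ := H.exists_parity hc (d := fun z => if z = Sum.inr i then 1 else 0)
        (by simp) (c (Sum.inr i))
      have hle : ∀ m : Fin (4 * k + 4),
          wdeg (addPathGraph G u v (4 * k + 4)) w (Sum.inr m) ≤ 2 :=
        fun m => (wdeg_mono (fun s => (hw s).trans (one_le_extendWeight s)) _).trans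
          (wdeg_extendWeight_inr (by omega) (fun _ => 1) (fun _ => 1) m).le

      refine ⟨w, hw, ?_, ?_, ?_⟩
      · have h1 := hpar (Sum.inr i)
        have h2 := hle i
        simp at h1
        omega
      · have h1 := hpar (Sum.inr j)
        have h2 := hle j
        rw [if_neg (hc hxy.symm), if_neg hxy.ne.symm] at h1
        omega
      · intro z hz
        have := hpar z
        rwa [if_neg hz] at this

/-- `w` is a `{0,1}`-weighting whose weighted degrees increased by `d` form a proper colouring. -/
def IsProperFor [Fintype V] (G : SimpleGraph V) (d : V → ℕ) (w : Sym2 V → ℕ) : Prop :=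
  (∀ e, w e ≤ 1) ∧ ∀ ⦃x y : V⦄, G.Adj x y → wdeg G w x + d x ≠ wdeg G w y + d y

/-- There are weights `e 0, …, e n` for a path with `n` internal vertices of demands `D i`,
with prescribed end weights `e₀`, `eₙ` and values `a`, `b` at the first and last internal vertex,
for which adjacent internal vertices have distinct values. -/
def PathExtends (n : ℕ) (D : ℕ → ℕ) (e₀ eₙ a b : ℕ) : Prop :=
  ∃ e : ℕ → ℕ, (∀ i, e i ≤ 1) ∧ e 0 = e₀ ∧ e n = eₙ ∧ e 0 + e 1 + D 0 = a ∧
    e (n - 1) + e n + D (n - 1) = b ∧ ∀ i, i + 1 < n → e i + D i ≠ e (i + 2) + D (i + 1)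

theorem PathExtends.reverse {n : ℕ} (hn : 1 ≤ n) {D D' : ℕ → ℕ}
    (hD : ∀ i < n, D' i = D (n - 1 - i)) {e₀ eₙ a b : ℕ} (h : PathExtends n D e₀ eₙ a b) :
    PathExtends n D' eₙ e₀ b a := by
  obtain ⟨e, he, rfl, rfl, rfl, rfl, h⟩ := h
  refine ⟨fun m => e (n - m), fun _ => he _, rfl, by simp, ?_, ?_, fun i hi => ?_⟩
  · rw [hD 0 (by omega)]
    simp only [Nat.sub_zero]
    omega
  · rw [hD _ (by omega)]
    simp only [Nat.sub_self, show n - (n - 1) = 1 by omega]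
    omega
  · have := h (n - 1 - (i + 1)) (by omega)
    rw [show n - 1 - (i + 1) + 2 = n - i by omega,
      show n - 1 - (i + 1) + 1 = n - 1 - i by omega] at this
    rw [hD i (by omega), hD _ hi]
    dsimp only
    rw [show n - (i + 2) = n - 1 - (i + 1) by omega]
    exact this.symm

/-- A path with `n` internal vertices of demands `D` can be added to `G` from `u` to `v` so that
a proper weighting for the total demand exists. -/
def Extendable [Fintype V] (G : SimpleGraph V) (u v : V) (d : V → ℕ) (n : ℕ) (D : ℕ → ℕ) :
    Prop :=
  ∃ e₀ eₙ a b w, PathExtends n D e₀ eₙ a b ∧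
    IsProperFor G (fun x => d x + (if x = u then e₀ else 0) + (if x = v then eₙ else 0)) w ∧
    wdeg G w u + d u + e₀ ≠ a ∧ wdeg G w v + d v + eₙ ≠ b

theorem Extendable.symm [Fintype V] {G : SimpleGraph V} {u v : V} {d : V → ℕ} {n : ℕ}
    (hn : 1 ≤ n) {D D' : ℕ → ℕ} (hD : ∀ i < n, D' i = D (n - 1 - i))
    (h : Extendable G u v d n D) : Extendable G v u d n D' := by
  obtain ⟨e₀, eₙ, a, b, w, h1, h2, h3, h4⟩ := h
  refine ⟨eₙ, e₀, b, a, w, h1.reverse hn hD, ?_, h4, h3⟩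
  simpa only [add_right_comm] using h2

theorem Extendable.exists_isProperFor [Fintype V] {G : SimpleGraph V} {u v : V} (huv : u ≠ v)
    {n : ℕ} (hn : 2 ≤ n) {d : V ⊕ Fin n → ℕ} {D : ℕ → ℕ} (hD : ∀ i, d (Sum.inr i) = D i)
    (h : Extendable G u v (fun x => d (Sum.inl x)) n D) :
    ∃ w, IsProperFor (addPathGraph G u v n) d w := by
  obtain ⟨e₀, eₙ, a, b, w, ⟨e, he, rfl, rfl, rfl, rfl, hp⟩, ⟨hw, hG⟩, hu, hv⟩ := h
  have hl : ∀ x i, (addPathGraph G u v n).Adj (Sum.inl x) (Sum.inr i) →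
      wdeg (addPathGraph G u v n) (extendWeight n w e) (Sum.inl x) + d (Sum.inl x) ≠
      wdeg (addPathGraph G u v n) (extendWeight n w e) (Sum.inr i) + d (Sum.inr i) := by
    intro x i h
    rw [wdeg_extendWeight_inl hn, wdeg_extendWeight_inr hn, hD]
    dsimp only at hu hv
    rcases addPathGraph_adj_inl_inr.1 h with ⟨rfl, h0⟩ | ⟨rfl, h0⟩
    · rw [h0, if_pos rfl, if_neg huv, zero_add]
      omega
    · rw [show i.1 = n - 1 by omega, if_pos rfl, if_neg huv.symm, show n - 1 + 1 = n by omega]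
      omega
  have hr : ∀ i j : Fin n, i.1 + 1 = j.1 →
      wdeg (addPathGraph G u v n) (extendWeight n w e) (Sum.inr i) + d (Sum.inr i) ≠
      wdeg (addPathGraph G u v n) (extendWeight n w e) (Sum.inr j) + d (Sum.inr j) := by
    intro i j h
    rw [wdeg_extendWeight_inr hn, wdeg_extendWeight_inr hn, hD, hD, ← h]
    have := hp i (by omega)
    rw [show i.1 + 1 + 1 = i.1 + 2 from rfl]
    omega
  refine ⟨extendWeight n w e, extendWeight_le_one hw he, ?_⟩
  rintro (x | i) (y | j) h
  · rw [wdeg_extendWeight_inl hn, wdeg_extendWeight_inl hn]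
    have := hG ((addPathGraph_adj_inl_inl (by omega)).1 h)
    dsimp only at this
    omega
  · exact hl x j h
  · exact (hl y i h.symm).symm
  · rcases addPathGraph_adj_inr_inr.1 h with h | h
    · exact hr i j h
    · exact (hr j i h).symm

theorem pathExtends_zero (k : ℕ) {a b : ℕ} (h : a + b = 1) :
    PathExtends (4 * k + 4) (fun _ => 0) 0 0 a b := by
  obtain ⟨rfl, rfl⟩ | ⟨rfl, rfl⟩ : a = 0 ∧ b = 1 ∨ a = 1 ∧ b = 0 := by omega
  · exact ⟨fun m => m / 2 % 2, fun m => by dsimp only; omega, by simp,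
      by dsimp only; omega, by simp, by dsimp only; omega, fun i _ => by dsimp only; omega⟩
  · exact ⟨fun m => (m + 1) / 2 % 2, fun m => by dsimp only; omega, by simp,
      by dsimp only; omega, by simp, by dsimp only; omega, fun i _ => by dsimp only; omega⟩

theorem pathExtends_single_one (k j : ℕ) (hj : j % 4 = 1) :
    PathExtends (4 * k + 4) (fun i => if i = j then 1 else 0) 0 0 1 0 := by
  refine ⟨fun m => (m + 1) / 2 % 2, fun m => by dsimp only; omega, by simp,
      by dsimp only; omega, ?_, ?_, fun i _ => ?_⟩ <;> dsimp only <;> split_ifs <;> omega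

theorem pathExtends_single_three (k j : ℕ) (hj : j % 4 = 3) (hjk : j ≠ 4 * k + 3) :
    PathExtends (4 * k + 4) (fun i => if i = j then 1 else 0) 1 1 1 2 := by
  refine ⟨fun m => (m + 3) / 2 % 2, fun m => by dsimp only; omega, by simp,
      by dsimp only; omega, ?_, ?_, fun i _ => ?_⟩ <;> dsimp only <;> split_ifs <;> omega

theorem pathExtends_single_last (k : ℕ) {a b : ℕ} (h : a + b = 3) (ha : a ≠ 0) (hb : b ≠ 0) :
    PathExtends (4 * k + 4) (fun i => if i = 4 * k + 3 then 1 else 0) 1 0 a b := by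
  obtain ⟨rfl, rfl⟩ | ⟨rfl, rfl⟩ : a = 1 ∧ b = 2 ∨ a = 2 ∧ b = 1 := by omega
  · refine ⟨fun m => if m = 4 * k + 4 then 0 else (m + 3) / 2 % 2, fun m => ?_,
      ?_, ?_, ?_, ?_, fun i _ => ?_⟩ <;> dsimp only <;> split_ifs <;> omega
  · refine ⟨fun m => if m = 4 * k + 4 then 0 else (m + 2) / 2 % 2, fun m => ?_,
      ?_, ?_, ?_, ?_, fun i _ => ?_⟩ <;> dsimp only <;> split_ifs <;> omega

theorem pathExtends_pair_one (k i j : ℕ) (hij : i ≤ j) (hi : i % 2 = 1) (hj : j % 4 = 1)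
    (hjk : j < 4 * k + 4) :
    PathExtends (4 * k + 4) (fun m => (if m = i then 1 else 0) + if m = j then 1 else 0)
      1 0 1 0 := by
  refine ⟨fun m => if m ≤ i then (m + 3) / 2 % 2 else (m + 1) / 2 % 2, fun m => ?_,
      ?_, ?_, ?_, ?_, fun m _ => ?_⟩ <;> dsimp only <;> split_ifs <;> omega

theorem pathExtends_pair_three (k i j : ℕ) (hij : i ≤ j) (hi : i % 2 = 1) (hj : j % 4 = 3)
    (hjk : j < 4 * k + 3) :
    PathExtends (4 * k + 4) (fun m => (if m = i then 1 else 0) + if m = j then 1 else 0)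
      0 1 1 2 := by
  refine ⟨fun m => if m ≤ i then (m + 1) / 2 % 2 else (m + 3) / 2 % 2, fun m => ?_,
      ?_, ?_, ?_, ?_, fun m _ => ?_⟩ <;> dsimp only <;> split_ifs <;> omega

theorem pathExtends_pair_one_last (k i : ℕ) (hi : i % 4 = 1) (hik : i < 4 * k + 3) :
    PathExtends (4 * k + 4)
      (fun m => (if m = i then 1 else 0) + if m = 4 * k + 3 then 1 else 0) 0 1 1 2 := by
  refine ⟨fun m => if m = 4 * k + 4 then 1 else (m + 1) / 2 % 2, fun m => ?_,
      ?_, ?_, ?_, ?_, fun m _ => ?_⟩ <;> dsimp only <;> split_ifs <;> first | omega | contradiction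

theorem pathExtends_pair_three_last (k i : ℕ) (hi : i % 4 = 3) (hik : i < 4 * k + 3) :
    PathExtends (4 * k + 4)
      (fun m => (if m = i then 1 else 0) + if m = 4 * k + 3 then 1 else 0) 0 1 0 3 := by
  refine ⟨fun m => if m ≤ i ∨ m % 2 = 1 then m / 2 % 2 else (m + 2) / 2 % 2, fun m => ?_,
      ?_, ?_, ?_, ?_, fun m _ => ?_⟩ <;> dsimp only <;> split_ifs <;> omega

theorem pathExtends_double_last (k : ℕ) :
    PathExtends (4 * k + 4)
      (fun m => (if m = 4 * k + 3 then 1 else 0) + if m = 4 * k + 3 then 1 else 0) 1 0 1 3 := by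
  refine ⟨fun m => if m = 4 * k + 4 then 0 else (m + 3) / 2 % 2, fun m => ?_,
      ?_, ?_, ?_, ?_, fun m _ => ?_⟩ <;> dsimp only <;> split_ifs <;> first | omega | contradiction

section extendable

variable [Fintype V] {G : SimpleGraph V} {green : Set (Sym2 V)} {c : V → Bool} {u v : V}

theorem Extendable.of_odd (h : OMC V G green) (hc : ∀ ⦃x y⦄, G.Adj x y → c x ≠ c y)
    (huv : c v ≠ c u) {d : V → ℕ} {n : ℕ} {D : ℕ → ℕ} {e₀ eₙ a b : ℕ}
    (hp : PathExtends n D e₀ eₙ a b) (hd : Odd (∑ x, d x + e₀ + eₙ))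
    (hab : a % 2 = 1 ∧ b % 2 = 0 ∨ a % 2 = 0 ∧ b % 2 = 1) :
    Extendable G u v d n D := by
  have hne : u ≠ v := fun h => huv (h ▸ rfl)
  obtain ⟨w, hw, hx⟩ := h.exists_parity hc
    (d := fun x => d x + (if x = u then e₀ else 0) + (if x = v then eₙ else 0))
    (by simpa [Finset.sum_add_distrib] using hd) (if a % 2 = 1 then c u else c v)
  refine ⟨e₀, eₙ, a, b, w, hp, ⟨hw, fun x y hxy heq => ?_⟩, ?_, ?_⟩
  · have h1 := hx x
    have h2 := hx y
    rw [heq, h2] at h1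
    have := hc hxy
    revert h1 this
    generalize (if a % 2 = 1 then c u else c v) = p
    cases p <;> cases c x <;> cases c y <;> simp
  · have h1 := hx u
    simp only [↓reduceIte, if_neg hne] at h1
    rcases hab with ⟨ha, hb⟩ | ⟨ha, hb⟩
    · simp only [if_pos ha, ↓reduceIte] at h1
      omega
    · simp only [ha, zero_ne_one, ↓reduceIte, if_neg huv.symm] at h1
      omega
  · have h1 := hx v
    simp only [↓reduceIte, if_neg hne.symm] at h1
    rcases hab with ⟨ha, hb⟩ | ⟨ha, hb⟩
    · simp only [if_pos ha, if_neg huv] at h1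
      omega
    · simp only [ha, zero_ne_one, ↓reduceIte] at h1
      omega

theorem extendable_zero (hadj : G.Adj u v) (k : ℕ) {d : V → ℕ} (hd : ∃ w, IsProperFor G d w) :
    Extendable G u v d (4 * k + 4) fun _ => 0 := by
  obtain ⟨w, hw⟩ := hd
  have huv := hw.2 hadj
  by_cases h : wdeg G w u + d u = 1 ∨ wdeg G w v + d v = 0
  · exact ⟨0, 0, 0, 1, w, pathExtends_zero k rfl, by simpa using hw, by omega, by omega⟩
  · exact ⟨0, 0, 1, 0, w, pathExtends_zero k rfl, by simpa using hw, by omega, by omega⟩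

theorem extendable_single (h : OMC V G green) (hc : ∀ ⦃x y⦄, G.Adj x y → c x ≠ c y)
    (hadj : G.Adj u v) (x : V)
    (ih : ∃ w, IsProperFor G (fun y => (if y = x then 1 else 0) + if y = u then 1 else 0) w)
    (k j : ℕ) (hj : j % 2 = 1) :
    Extendable G u v (fun y => if y = x then 1 else 0) (4 * k + 4)
      fun i => if i = j then 1 else 0 := by
  by_cases h1 : j % 4 = 1
  · exact .of_odd h hc (hc hadj.symm) (pathExtends_single_one k j h1) (by simp) (by simp)
  by_cases h2 : j = 4 * k + 3
  · obtain ⟨w, hw⟩ := ih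
    subst h2
    have huv := hw.2 hadj
    simp only [if_pos, if_neg hadj.ne.symm] at huv
    have hw' : IsProperFor G (fun y => (if y = x then 1 else 0) + (if y = u then 1 else 0) +
      if y = v then 0 else 0) w := by simpa using hw
    by_cases h3 : wdeg G w u + (if u = x then 1 else 0) + 1 = 1 ∨
      wdeg G w v + (if v = x then 1 else 0) + 0 = 2
    · refine ⟨1, 0, 2, 1, w, pathExtends_single_last k rfl (by simp) (by simp), hw', ?_, ?_⟩ <;>
        dsimp only <;> omega
    · refine ⟨1, 0, 1, 2, w, pathExtends_single_last k rfl (by simp) (by simp), hw', ?_, ?_⟩ <;>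
        dsimp only <;> omega
  · exact .of_odd h hc (hc hadj.symm) (pathExtends_single_three k j (by omega) h2)
      (by simp; decide) (by simp)

theorem extendable_pair (h : OMC V G green) (hc : ∀ ⦃x y⦄, G.Adj x y → c x ≠ c y)
    (hadj : G.Adj u v) (hgreen : s(u, v) ∈ green) (k i j : ℕ) (hij : i ≤ j) (hi : i % 2 = 1)
    (hj : j % 2 = 1) (hjk : j < 4 * k + 4) :
    Extendable G u v (fun _ => 0) (4 * k + 4)
      fun m => (if m = i then 1 else 0) + if m = j then 1 else 0 := by
  have huv : c v ≠ c u := hc hadj.symm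
  by_cases h1 : j % 4 = 1
  · exact .of_odd h hc huv (pathExtends_pair_one k i j hij hi h1 hjk) (by simp) (by simp)
  by_cases h2 : j = 4 * k + 3
  · subst h2
    by_cases h3 : i = 4 * k + 3
    · subst h3
      obtain ⟨w, hw, hu, hv, hz⟩ := h.exists_wdeg_eq_one hc hadj hgreen
      refine ⟨1, 0, 1, 3, w, pathExtends_double_last k, ⟨hw, ?_⟩,
        by simp [hu], by simp [hv]⟩
      have hz' : ∀ z, (wdeg G w z + (0 + (if z = u then 1 else 0) + if z = v then 0 else 0)) % 2
          = if c z = c u then 0 else 1 := by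
        intro z
        by_cases hzu : z = u
        · subst hzu
          simp [hu]
        · simpa [hzu] using hz z hzu
      intro x y hxy heq
      have h1 := hz' x
      have h2 := hz' y
      rw [heq, h2] at h1
      have := hc hxy
      revert h1 this
      cases c u <;> cases c x <;> cases c y <;> simp
    · by_cases h4 : i % 4 = 1
      · exact .of_odd h hc huv (pathExtends_pair_one_last k i h4 (by omega)) (by simp) (by simp)
      · exact .of_odd h hc huv (pathExtends_pair_three_last k i (by omega) (by omega)) (by simp)
          (by simp)
  · exact .of_odd h hc huv (pathExtends_pair_three k i j hij hi (by omega) (by omega)) (by simp)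
      (by simp)

end extendable

theorem OMC.exists_isProperFor {G : SimpleGraph V} {green : Set (Sym2 V)}
    (h : OMC V G green) : ∀ [Fintype V] (c : V → Bool), (∀ ⦃x y⦄, G.Adj x y → c x ≠ c y) →
    ∀ p q : V, c p = c q →
      ∃ w, IsProperFor G (fun x => (if x = p then 1 else 0) + if x = q then 1 else 0) w := by
  induction h with
  | k2 =>
    intro inst c hc p q hpq
    obtain rfl : inst = Fin.fintype 2 := Subsingleton.elim _ _
    obtain rfl : p = q := by
      by_contra hne
      exact hc (by simpa using hne) hpq
    refine ⟨fun _ => 0, fun _ => by simp, fun x y hxy => ?_⟩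
    rw [wdeg_top_fin_two, wdeg_top_fin_two]
    have : x ≠ y := hxy.ne
    dsimp only
    split_ifs <;> omega
  | @addPath V G green h u v hadj hgreen k ih =>
    intro inst c hc p q hpq
    have : Fintype V := Fintype.ofInjective _ (Sum.inl_injective (β := Fin (4 * k + 4)))
    obtain rfl : inst = instFintypeSum V (Fin (4 * k + 4)) := Subsingleton.elim _ _
    have huv : u ≠ v := hadj.ne
    have hc' := addPathGraph_coloring_inl (by omega) hc
    have hcuv : c (Sum.inl u) ≠ c (Sum.inl v) := hc' hadj
    have hci := addPathGraph_coloring_inr hc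
    have hgreen' : s(v, u) ∈ green := by rwa [Sym2.eq_swap]
    have single : ∀ (x : V) (j : Fin (4 * k + 4)), c (Sum.inl x) = c (Sum.inr j) →
        Extendable G u v (fun y => if y = x then 1 else 0) (4 * k + 4)
          (fun i => if i = j then 1 else 0) := by
      intro x j hxj
      have hjlt := j.2
      rw [hci] at hxj
      by_cases hj : j.1 % 2 = 1
      · rw [if_pos hj] at hxj
        exact extendable_single h hc' hadj x (ih _ hc' x u hxj) k j hj
      · rw [if_neg hj, ← Bool.eq_not.2 hcuv.symm] at hxj
        refine (extendable_single h hc' hadj.symm x (ih _ hc' x v hxj) k (4 * k + 3 - j)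
          (by omega)).symm (by omega) fun i hi => ?_
        congr 1
        simp only [eq_iff_iff]
        omega
    have pair : ∀ i j : Fin (4 * k + 4), i ≤ j → c (Sum.inr i) = c (Sum.inr j) →
        Extendable G u v (fun _ => 0) (4 * k + 4)
          (fun m => (if m = i.1 then 1 else 0) + if m = j.1 then 1 else 0) := by
      intro i j hij hcij
      have hjlt := j.2
      have hilt := i.2
      have hij' : i.1 ≤ j.1 := hij
      rw [hci, hci] at hcij
      by_cases hj : j.1 % 2 = 1
      · have hi : i.1 % 2 = 1 := by
          by_contra hi
          simp [hi, hj] at hcij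
        exact extendable_pair h hc' hadj hgreen k i j hij' hi hj hjlt
      · have hi : ¬ i.1 % 2 = 1 := by
          intro hi
          simp [hi, hj] at hcij
        refine (extendable_pair h hc' hadj.symm hgreen' k (4 * k + 3 - j) (4 * k + 3 - i)
          (by omega) (by omega) (by omega) (by omega)).symm (by omega) fun m hm => ?_
        split_ifs <;> omega
    rcases p with p | i <;> rcases q with q | j
    · refine Extendable.exists_isProperFor huv (by omega) (D := fun _ => 0) (by simp) ?_
      simpa using extendable_zero hadj k (ih _ hc' p q hpq)
    · refine Extendable.exists_isProperFor huv (by omega) (D := fun i => if i = j then 1 else 0)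
        (by simp [Fin.ext_iff]) ?_
      simpa using single p j hpq
    · refine Extendable.exists_isProperFor huv (by omega) (D := fun j => if j = i then 1 else 0)
        (by simp [Fin.ext_iff]) ?_
      simpa using single q i hpq.symm
    · rcases le_total i j with hij | hij
      · refine Extendable.exists_isProperFor huv (by omega)
          (D := fun m => (if m = i.1 then 1 else 0) + if m = j.1 then 1 else 0)
          (by simp [Fin.ext_iff]) ?_
        simpa using pair i j hij hpq
      · refine Extendable.exists_isProperFor huv (by omega)
          (D := fun m => (if m = j.1 then 1 else 0) + if m = i.1 then 1 else 0)
          (by simp [Fin.ext_iff, add_comm]) ?_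
        simpa using pair j i hij hpq.symm

theorem wdeg_map_iso {W : Type} [Fintype V] [Fintype W] {G : SimpleGraph V} {H : SimpleGraph W}
    (f : G ≃g H) (w : Sym2 W → ℕ) (x : V) :
    wdeg G (fun e => w (e.map f)) x = wdeg H w (f x) := by
  unfold wdeg
  rw [Finset.sum_filter, Finset.sum_filter, ← f.toEquiv.sum_comp]
  refine Finset.sum_congr rfl fun y _ => ?_
  simp [f.map_adj_iff]

end

/-- In a simple odd multi-cactus different from `K₂`, for any two vertices
`u, v` in the same bipartition class (possibly `u = v`), there is a `{0,1}`-weighting such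
that the vertex colouring obtained from the weighted degrees by adding `1` at `u` and `1`
at `v` (hence `2` at `u = v` if they coincide) is a proper vertex colouring. -/
theorem statement3 {V : Type} [Fintype V] (G : SimpleGraph V)
    (h : IsSimpleOddMultiCactus G) (hK2 : ¬ Nonempty (G ≃g (⊤ : SimpleGraph (Fin 2))))
    (c : V → Bool) (hc : ∀ ⦃x y : V⦄, G.Adj x y → c x ≠ c y)
    (u v : V) (huv : c u = c v) :
    ∃ w : Sym2 V → ℕ, Is01Weighting G w ∧
      ∀ ⦃x y : V⦄, G.Adj x y →
        wdeg G w x + (if x = u then 1 else 0) + (if x = v then 1 else 0) ≠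
          wdeg G w y + (if y = u then 1 else 0) + (if y = v then 1 else 0) := by
  obtain ⟨W, H, green, hH, ⟨f⟩⟩ := h
  have := hH.finite
  have : Fintype W := Fintype.ofFinite W
  obtain ⟨w, hw, hw'⟩ := hH.exists_isProperFor (fun x => c (f.symm x))
    (fun x y hxy => hc (f.symm.map_adj_iff.2 hxy)) (f u) (f v) (by simpa using huv)
  refine ⟨fun e => w (e.map f), fun e _ => ?_, fun x y hxy => ?_⟩
  · have := hw (e.map f)
    dsimp only
    omega
  · have := hw' (f.map_adj_iff.2 hxy)
    rw [wdeg_map_iso, wdeg_map_iso]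
    simpa only [f.injective.eq_iff, add_assoc] using this
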